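/- For each n ≥ 3 there is a rotationally symmetric Riemannian metric g = dr² + f(r)² g₀ on the punctured ball {x ∈ ℝⁿ : 0 < ‖x‖ < π/2} (extending smoothly over the origin), constructed as follows: let c ∈ (0, π/2) be the unique solution of sin(r) = −r + π/2, choose ε > 0 with [c−ε, c+ε] ⊂ (0, π/2), and let h : [c−ε, c+ε] → (0,∞) be a smooth function with h'' ≤ 0 and −1 ≤ h' ≤ 1 agreeing to second order with sin(r) at c−ε and with −r + π/2 at c+ε; set f(r) = sin(r) for r < c−ε, f(r) = h(r) on [c−ε, c+ε], and f(r) = −r + π/2 for r > c+ε. This metric satisfies K ≥ 0 everywhere, K = 0 at every point of the sphere ∂B_0(c+ε) (on every tangent 2-plane), and K = 1 at every point of the ball B_0(c−ε). Consequently, the conclusion of Theorem B fails when the hypothesis K ≤ a is replaced by K ≥ a. -/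

import Mathlib

open Set Filter Topology

/-- The smooth transition function is symmetric about `1 / 2`. -/
theorem Real.smoothTransition_add_one_sub (x : ℝ) :
    Real.smoothTransition x + Real.smoothTransition (1 - x) = 1 := by
  have h := (Real.smoothTransition.pos_denom x).ne'
  have h' : expNegInvGlue (1 - x) + expNegInvGlue x ≠ 0 := by rwa [add_comm]
  simp only [Real.smoothTransition, sub_sub_cancel]
  field_simp
  ring

/-- A smooth convex function equal to `max 0` outside of `(-δ, δ)`. -/
theorem exists_smooth_convex_posPart {δ : ℝ} (hδ : 0 < δ) :
    ∃ G : ℝ → ℝ, ContDiff ℝ (⊤ : ℕ∞) G ∧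
      (∀ x, 0 ≤ deriv G x ∧ deriv G x ≤ 1 ∧ 0 ≤ deriv (deriv G) x) ∧
      (∀ x ≤ -δ, G x = 0 ∧ deriv G x = 0 ∧ deriv (deriv G) x = 0) ∧
      (∀ x, δ ≤ x → G x = x ∧ deriv G x = 1 ∧ deriv (deriv G) x = 0) := by
  set χ : ℝ → ℝ := fun x => Real.smoothTransition ((x + δ) / (2 * δ)) with hχ
  have χ_smooth : ContDiff ℝ (⊤ : ℕ∞) χ :=
    Real.smoothTransition.contDiff.comp (by fun_prop)
  have χ_mono : Monotone χ := fun x y hxy => Real.smoothTransition.monotone (by gcongr)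
  have χ_nonneg (x : ℝ) : 0 ≤ χ x := Real.smoothTransition.nonneg _
  have χ_le_one (x : ℝ) : χ x ≤ 1 := Real.smoothTransition.le_one _
  have χ_left {x : ℝ} (hx : x ≤ -δ) : χ x = 0 :=
    Real.smoothTransition.zero_of_nonpos
      (div_nonpos_of_nonpos_of_nonneg (by linarith) (by positivity))
  have χ_right {x : ℝ} (hx : δ ≤ x) : χ x = 1 :=
    Real.smoothTransition.one_of_one_le (by rw [le_div_iff₀ (by positivity)]; linarith)
  have χ_symm (x : ℝ) : χ x + χ (-x) = 1 := by
    rw [← Real.smoothTransition_add_one_sub ((x + δ) / (2 * δ))]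
    simp only [hχ]
    congr 2
    field_simp
    ring
  set G : ℝ → ℝ := fun x => ∫ t in (-δ)..x, χ t
  have G_deriv (x : ℝ) : HasDerivAt G (χ x) x :=
    (χ_smooth.continuous.integral_hasStrictDerivAt (-δ) x).hasDerivAt
  have deriv_G : deriv G = χ := funext fun x => (G_deriv x).deriv
  have G_left {x : ℝ} (hx : x ≤ -δ) : G x = 0 := by
    refine (intervalIntegral.integral_congr (g := fun _ => (0 : ℝ)) fun t ht => ?_).trans (by simp)
    rw [uIcc_of_ge hx] at ht
    exact χ_left ht.2
  have G_symm (x : ℝ) : G x - G (-x) - x = 0 := by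
    have key (y : ℝ) : HasDerivAt (fun z => G z - G (-z) - z) 0 y := by
      have := ((G_deriv y).sub ((G_deriv (-y)).comp y (hasDerivAt_neg y))).sub (hasDerivAt_id y)
      exact this.congr_deriv (by linear_combination χ_symm y)
    have := is_const_of_deriv_eq_zero (fun y => (key y).differentiableAt)
      (fun y => (key y).deriv) x 0
    simpa using this
  refine ⟨G, ?_, fun x => ?_, fun x hx => ?_, fun x hx => ?_⟩
  · rw [contDiff_infty_iff_deriv, deriv_G]
    exact ⟨fun x => (G_deriv x).differentiableAt, χ_smooth⟩
  · rw [deriv_G]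
    exact ⟨χ_nonneg x, χ_le_one x, χ_mono.deriv_nonneg⟩
  · rw [deriv_G]
    refine ⟨G_left hx, χ_left hx, IsLocalMin.deriv_eq_zero (.of_forall fun y => ?_)⟩
    rw [χ_left hx]
    exact χ_nonneg y
  · rw [deriv_G]
    refine ⟨?_, χ_right hx, IsLocalMax.deriv_eq_zero (.of_forall fun y => ?_)⟩
    · linarith [G_symm x, G_left (neg_le_neg hx)]
    · rw [χ_right hx]
      exact χ_le_one y

/-- The derivative of `r ↦ sin r - G (sin r + r - π / 2)` interpolates between `cos` and `-1`. -/
theorem hasDerivAt_sin_sub_comp {G : ℝ → ℝ} (hG : Differentiable ℝ G) (r : ℝ) :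
    HasDerivAt (fun r => Real.sin r - G (Real.sin r + r - Real.pi / 2))
      (Real.cos r - deriv G (Real.sin r + r - Real.pi / 2) * (Real.cos r + 1)) r :=
  (Real.hasDerivAt_sin r).sub <| (hG _).hasDerivAt.comp r <|
    ((Real.hasDerivAt_sin r).add (hasDerivAt_id r)).sub_const _

theorem hasDerivAt_cos_sub_deriv_comp_mul {G : ℝ → ℝ} (hG : Differentiable ℝ (deriv G)) (r : ℝ) :
    HasDerivAt
      (fun r => Real.cos r - deriv G (Real.sin r + r - Real.pi / 2) * (Real.cos r + 1))
      (-((1 - deriv G (Real.sin r + r - Real.pi / 2)) * Real.sin r +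
        deriv (deriv G) (Real.sin r + r - Real.pi / 2) * (Real.cos r + 1) ^ 2)) r := by
  have hu : HasDerivAt (fun r => Real.sin r + r - Real.pi / 2) (Real.cos r + 1) r :=
    ((Real.hasDerivAt_sin r).add (hasDerivAt_id r)).sub_const _
  have := (Real.hasDerivAt_cos r).sub
    (((hG _).hasDerivAt.comp r hu).mul ((Real.hasDerivAt_cos r).add_const 1))
  exact this.congr_deriv (by simp only [Function.comp]; ring)

theorem monotone_sin_add_id : Monotone fun r => Real.sin r + r :=
  monotone_of_deriv_nonneg (by fun_prop) fun r => by
    have h : HasDerivAt (fun r => Real.sin r + r) (Real.cos r + 1) r :=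
      (Real.hasDerivAt_sin r).add (hasDerivAt_id r)
    rw [h.deriv]
    linarith [Real.neg_one_le_cos r]

theorem strictMonoOn_sin_add_id :
    StrictMonoOn (fun r => Real.sin r + r) (Icc 0 (Real.pi / 2)) :=
  (Real.strictMonoOn_sin.mono (Icc_subset_Icc (by linarith [Real.pi_pos]) le_rfl)).add
    strictMonoOn_id


/-- **The counterexample of Section 3.**  For each `n ≥ 3` there is a rotationally
symmetric metric `g = dr² + f(r)² g₀` on the punctured ball
`{x ∈ ℝⁿ : 0 < ‖x‖ < π/2}` (extending smoothly over the origin) with `K ≥ 0`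
everywhere, `K = 0` on the sphere `∂B_0(c+ε)`, and `K = 1` on the ball `B_0(c−ε)`;
hence Theorem B fails with `K ≥ a` in place of `K ≤ a`.

Here `c ∈ (0, π/2)` is the unique solution of `sin r = −r + π/2`, `ε > 0` satisfies
`[c−ε, c+ε] ⊂ (0, π/2)`, and `h : [c−ε, c+ε] → (0, ∞)` is a smooth function with
`h'' ≤ 0` and `−1 ≤ h' ≤ 1` agreeing to second order with `sin r` at `c−ε` and with
`−r + π/2` at `c+ε`; the warping function is `f(r) = sin r` for `r < c−ε`,
`f(r) = h(r)` on `[c−ε, c+ε]`, and `f(r) = −r + π/2` for `r > c+ε`.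

All sectional curvatures of `g` at radius `r` lie between `−f''(r)/f(r)` (attained on
planes containing the radial direction) and `(1 − f'(r)²)/f(r)²` (attained on planes
tangent to the spheres), so the curvature assertions are expressed through these two
quantities. -/
theorem exists_rotationally_symmetric_counterexample (n : ℕ) (hn : 3 ≤ n) :
    ∃ c ε : ℝ, ∃ h f : ℝ → ℝ,
      -- `c` is the unique solution in `(0, π/2)` of `sin r = −r + π/2`
      c ∈ Set.Ioo 0 (Real.pi / 2) ∧ Real.sin c = -c + Real.pi / 2 ∧
      (∀ c' ∈ Set.Ioo 0 (Real.pi / 2), Real.sin c' = -c' + Real.pi / 2 → c' = c) ∧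
      -- `ε` is chosen with `[c−ε, c+ε] ⊂ (0, π/2)`
      0 < ε ∧ Set.Icc (c - ε) (c + ε) ⊆ Set.Ioo 0 (Real.pi / 2) ∧
      -- `h` is smooth, positive, concave, with `−1 ≤ h' ≤ 1` on `[c−ε, c+ε]`
      ContDiffOn ℝ (⊤ : ℕ∞) h (Set.Icc (c - ε) (c + ε)) ∧
      (∀ r ∈ Set.Icc (c - ε) (c + ε),
        0 < h r ∧ deriv (deriv h) r ≤ 0 ∧ -1 ≤ deriv h r ∧ deriv h r ≤ 1) ∧
      -- `h` agrees to second order with `sin` at `c−ε` …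
      h (c - ε) = Real.sin (c - ε) ∧ deriv h (c - ε) = Real.cos (c - ε) ∧
      deriv (deriv h) (c - ε) = -Real.sin (c - ε) ∧
      -- … and with `−r + π/2` at `c+ε`
      h (c + ε) = -(c + ε) + Real.pi / 2 ∧ deriv h (c + ε) = -1 ∧
      deriv (deriv h) (c + ε) = 0 ∧
      -- the warping function `f`
      (∀ r : ℝ, r < c - ε → f r = Real.sin r) ∧
      (∀ r ∈ Set.Icc (c - ε) (c + ε), f r = h r) ∧
      (∀ r : ℝ, c + ε < r → f r = -r + Real.pi / 2) ∧
      -- `K ≥ 0` everywhere on the punctured ball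
      (∀ r ∈ Set.Ioo 0 (Real.pi / 2),
        0 ≤ -(deriv (deriv f) r) / f r ∧ 0 ≤ (1 - deriv f r ^ 2) / f r ^ 2) ∧
      -- `K = 0` at every point of the sphere `∂B_0(c+ε)`, on every tangent 2-plane
      -(deriv (deriv f) (c + ε)) / f (c + ε) = 0 ∧
      (1 - deriv f (c + ε) ^ 2) / f (c + ε) ^ 2 = 0 ∧
      -- `K = 1` at every point of the ball `B_0(c−ε)`
      (∀ r ∈ Set.Ioo 0 (c - ε),
        -(deriv (deriv f) r) / f r = 1 ∧ (1 - deriv f r ^ 2) / f r ^ 2 = 1) := by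
  have hπ := Real.pi_pos
  obtain ⟨c, hc, hc0⟩ : ∃ c ∈ Ioo 0 (Real.pi / 2), Real.sin c + c = Real.pi / 2 := by
    refine intermediate_value_Ioo (f := fun r => Real.sin r + r) (by positivity)
      (by fun_prop) ⟨?_, ?_⟩ <;> simp [hπ]
  obtain ⟨ε, hε, hεl, hεr⟩ : ∃ ε, 0 < ε ∧ 0 < c - ε ∧ c + ε < Real.pi / 2 := by
    obtain ⟨ε, hε, h⟩ := exists_between (lt_min hc.1 (sub_pos.2 hc.2))
    exact ⟨ε, hε, by linarith [h.trans_le (min_le_left _ _)],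
      by linarith [h.trans_le (min_le_right _ _)]⟩
  set a := c - ε with ha
  set b := c + ε with hb
  have hua : Real.sin a + a < Real.pi / 2 := hc0 ▸
    strictMonoOn_sin_add_id ⟨hεl.le, by linarith⟩ ⟨hc.1.le, hc.2.le⟩ (by linarith)
  have hub : Real.pi / 2 < Real.sin b + b := hc0 ▸
    strictMonoOn_sin_add_id ⟨hc.1.le, hc.2.le⟩ ⟨by linarith, hεr.le⟩ (by linarith)
  have hsa : 0 < Real.sin a := Real.sin_pos_of_pos_of_lt_pi hεl (by linarith)
  obtain ⟨δ, hδ, hδ'⟩ := exists_between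
    (lt_min (lt_min (sub_pos.2 hua) (sub_pos.2 hub)) hsa)
  simp only [lt_min_iff] at hδ'
  obtain ⟨⟨hδa, hδb⟩, hδs⟩ := hδ'
  obtain ⟨G, G_smooth, G_mid, G_left, G_right⟩ := exists_smooth_convex_posPart hδ
  have G'_smooth : ContDiff ℝ (⊤ : ℕ∞) (deriv G) := (contDiff_infty_iff_deriv.1 G_smooth).2
  have G_mono : Monotone G := monotone_of_deriv_nonneg (G_smooth.differentiable (by simp))
    fun x => (G_mid x).1
  set F : ℝ → ℝ := fun r => Real.sin r - G (Real.sin r + r - Real.pi / 2) with hF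
  have F_smooth : ContDiff ℝ (⊤ : ℕ∞) F :=
    Real.contDiff_sin.sub (G_smooth.comp ((Real.contDiff_sin.add contDiff_id).sub contDiff_const))
  have hF' : deriv F =
      fun r => Real.cos r - deriv G (Real.sin r + r - Real.pi / 2) * (Real.cos r + 1) :=
    funext fun r => (hasDerivAt_sin_sub_comp (G_smooth.differentiable (by simp)) r).deriv
  have hF'' (r : ℝ) : deriv (deriv F) r =
      -((1 - deriv G (Real.sin r + r - Real.pi / 2)) * Real.sin r +
        deriv (deriv G) (Real.sin r + r - Real.pi / 2) * (Real.cos r + 1) ^ 2) := by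
    rw [hF']
    exact (hasDerivAt_cos_sub_deriv_comp_mul (G'_smooth.differentiable (by simp)) r).deriv
  have F_left {r : ℝ} (hr : r ≤ a) :
      F r = Real.sin r ∧ deriv F r = Real.cos r ∧ deriv (deriv F) r = -Real.sin r := by
    have hu : Real.sin r + r ≤ Real.sin a + a := monotone_sin_add_id hr
    obtain ⟨h0, h1, h2⟩ := G_left (Real.sin r + r - Real.pi / 2) (by linarith)
    refine ⟨?_, ?_, ?_⟩
    · simp [hF, h0]
    · simp [hF', h1]
    · simp [hF'', h1, h2]
  have F_right {r : ℝ} (hr : b ≤ r) :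
      F r = -r + Real.pi / 2 ∧ deriv F r = -1 ∧ deriv (deriv F) r = 0 := by
    have hu : Real.sin b + b ≤ Real.sin r + r := monotone_sin_add_id hr
    obtain ⟨h0, h1, h2⟩ := G_right (Real.sin r + r - Real.pi / 2) (by linarith)
    refine ⟨?_, ?_, ?_⟩
    · simp only [hF, h0]; ring
    · simp [hF', h1]
    · simp [hF'', h1, h2]
  have F'_bound (r : ℝ) : -1 ≤ deriv F r ∧ deriv F r ≤ 1 := by
    obtain ⟨h0, h1, -⟩ := G_mid (Real.sin r + r - Real.pi / 2)
    have := Real.neg_one_le_cos r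
    have := Real.cos_le_one r
    rw [hF']
    constructor <;> nlinarith
  have F_pos {r : ℝ} (hr : r ∈ Ioo 0 (Real.pi / 2)) : 0 < F r := by
    have hs : 0 < Real.sin r := Real.sin_pos_of_pos_of_lt_pi hr.1 (by linarith [hr.2])
    rcases le_total r a with hra | hra
    · rwa [(F_left hra).1]
    rcases le_total δ (Real.sin r + r - Real.pi / 2) with hu | hu
    · simp only [hF, (G_right _ hu).1]
      linarith [hr.2]
    · have : Real.sin a ≤ Real.sin r :=
        Real.sin_le_sin_of_le_of_le_pi_div_two (by linarith) hr.2.le hra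
      have := G_mono hu
      simp only [(G_right δ le_rfl).1] at this
      simp only [hF]
      linarith
  have F''_nonpos {r : ℝ} (hr : r ∈ Ioo 0 (Real.pi / 2)) : deriv (deriv F) r ≤ 0 := by
    have hs : 0 < Real.sin r := Real.sin_pos_of_pos_of_lt_pi hr.1 (by linarith [hr.2])
    obtain ⟨-, h1, h2⟩ := G_mid (Real.sin r + r - Real.pi / 2)
    have := sub_nonneg.2 h1
    rw [hF'', neg_nonpos]
    positivity
  have hsub : Icc a b ⊆ Ioo 0 (Real.pi / 2) := Icc_subset_Ioo hεl hεr
  refine ⟨c, ε, F, F, hc, by linarith, fun c' hc' h => ?_, hε, hsub, F_smooth.contDiffOn,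
    fun r hr => ⟨F_pos (hsub hr), F''_nonpos (hsub hr), F'_bound r⟩,
    (F_left le_rfl).1, (F_left le_rfl).2.1, (F_left le_rfl).2.2,
    (F_right le_rfl).1, (F_right le_rfl).2.1, (F_right le_rfl).2.2,
    fun r hr => (F_left hr.le).1, fun _ _ => rfl, fun r hr => (F_right hr.le).1,
    fun r hr => ⟨?_, ?_⟩, ?_, ?_, fun r hr => ?_⟩
  · exact strictMonoOn_sin_add_id.injOn (Ioo_subset_Icc_self hc') (Ioo_subset_Icc_self hc)
      (by linarith)
  · exact div_nonneg (neg_nonneg.2 (F''_nonpos hr)) (F_pos hr).le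
  · obtain ⟨h1, h2⟩ := F'_bound r
    exact div_nonneg (by nlinarith) (sq_nonneg _)
  · rw [(F_right le_rfl).2.2, neg_zero, zero_div]
  · rw [(F_right le_rfl).2.1]
    norm_num
  · have hs : Real.sin r ≠ 0 :=
      (Real.sin_pos_of_pos_of_lt_pi hr.1 (by linarith [hr.2])).ne'
    obtain ⟨h0, h1, h2⟩ := F_left hr.2.le
    rw [h0, h1, h2, neg_neg, ← Real.sin_sq]
    exact ⟨div_self hs, div_self (pow_ne_zero 2 hs)⟩
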